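/- arXiv:2206.03151 — 7 statements merged into one kernel-verified Lean document; each statement's English description precedes it below -/
import Mathlib

section
/- Theorem 3.2 (analytic core of the RDP upper bound for shuffled check-in). Let n ∈ ℕ, ε0 ≥ 0, γ ∈ (0,1], let λ ≥ 2 be an integer, and let Δ ∈ [0,1] be such that m := (1−Δ)nγ is a positive integer with m < n. Define G(0) = 1 and G(k) = F(k) for 1 ≤ k ≤ n, with F as in the context. Then Σ_{k=0}^{n} w_k · G(k) ≤ 1 + 4·C(λ,2)·γ²·(e^{ε0}−1)²·( e^{−ε0−Δ²nγ/2} + e^{−ε0}/l̃ ) + Σ_{j=3}^{λ} C(λ,j)·γ^j · j · Γ(j/2) · ( 2(e^{2ε0}−1)²/e^{2ε0} )^{j/2} · ( e^{−Δ²nγ/2} + l̃^{−j/2} ) + Υ_1 · e^{−Δ²nγ/2} + Υ_{m+1}, where l̃ = ⌊(1−Δ)nγ/(2e^{ε0})⌋ + 1 and w_k = C(n,k) γ^k (1−γ)^{n−k}. -/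
open Finset

/-- `k̄ = ⌊(k−1)/(2 e^{ε0})⌋ + 1`. -/
noncomputable def kbar (ε0 : ℝ) (k : ℕ) : ℕ :=
  ⌊((k : ℝ) - 1) / (2 * Real.exp ε0)⌋₊ + 1

/-- `Υ_k = ((1 + γ(e^{2ε0}−1)/e^{ε0})^λ − 1 − λγ(e^{2ε0}−1)/e^{ε0}) · e^{−(k−1)/(8 e^{ε0})}`. -/
noncomputable def Upsilon (ε0 γ : ℝ) (lam : ℕ) (k : ℕ) : ℝ :=
  ((1 + γ * (Real.exp (2 * ε0) - 1) / Real.exp ε0) ^ lam - 1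
      - (lam : ℝ) * γ * (Real.exp (2 * ε0) - 1) / Real.exp ε0)
    * Real.exp (-((k : ℝ) - 1) / (8 * Real.exp ε0))

/-- The cited upper bound `F(k)` (Lemma A.1, Girgis et al.) on the `λ`-th moment of the
likelihood ratio of a shuffle mechanism over `k` participants with subsampling rate `γ`
and an `ε0`-LDP randomizer. -/
noncomputable def Fbound (ε0 γ : ℝ) (lam : ℕ) (k : ℕ) : ℝ :=
  1 + 4 * (lam.choose 2 : ℝ) * γ ^ 2 * (Real.exp ε0 - 1) ^ 2
        / ((kbar ε0 k : ℝ) * Real.exp ε0)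
    + ∑ j ∈ Finset.Icc 3 lam,
        (lam.choose j : ℝ) * γ ^ j * (j : ℝ) * Real.Gamma ((j : ℝ) / 2)
          * (2 * (Real.exp (2 * ε0) - 1) ^ 2 / ((kbar ε0 k : ℝ) * Real.exp (2 * ε0)))
              ^ ((j : ℝ) / 2)
    + Upsilon ε0 γ lam k

/-- `l̃ = ⌊(1−Δ)nγ/(2 e^{ε0})⌋ + 1`. -/
noncomputable def ltilde (ε0 γ Δ : ℝ) (n : ℕ) : ℕ :=
  ⌊(1 - Δ) * (n : ℝ) * γ / (2 * Real.exp ε0)⌋₊ + 1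


lemma aux_x_log {x : ℝ} (hx0 : 0 < x) (hx1 : x ≤ 1) : (x ^ 2 - 1) / 2 ≤ x * Real.log x := by
  have ht : 0 ≤ -Real.log x := by
    have := Real.log_nonpos hx0.le hx1
    linarith
  have h := Real.self_le_sinh_iff.mpr ht
  rw [Real.sinh_eq, neg_neg, Real.exp_neg, Real.exp_log hx0] at h
  have h2 := mul_le_mul_of_nonneg_left h hx0.le
  have h3 : x * ((x⁻¹ - x) / 2) = (1 - x ^ 2) / 2 := by
    field_simp
  rw [h3] at h2
  linarith

lemma aux_binom (n : ℕ) (γ x : ℝ) :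
    ∑ k ∈ Finset.range (n + 1), (n.choose k : ℝ) * γ ^ k * (1 - γ) ^ (n - k) * x ^ k
      = (1 - γ * (1 - x)) ^ n := by
  have h : (1 - γ * (1 - x)) = γ * x + (1 - γ) := by ring
  rw [h, add_pow]
  refine Finset.sum_congr rfl fun k _ => ?_
  rw [mul_pow]; ring

lemma aux_chernoff (n : ℕ) (γ Δ : ℝ) (hγ0 : 0 < γ) (hγ1 : γ ≤ 1)
    (hΔ0 : 0 ≤ Δ) (hΔ1 : Δ < 1) (m : ℕ) (hm : (m : ℝ) = (1 - Δ) * (n : ℝ) * γ) :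
    ∑ k ∈ Finset.range (n + 1),
        (n.choose k : ℝ) * γ ^ k * (1 - γ) ^ (n - k) * (if k ≤ m then 1 else 0)
      ≤ Real.exp (-Δ ^ 2 * (n : ℝ) * γ / 2) := by
  have hx0 : 0 < 1 - Δ := by linarith
  have hx1 : 1 - Δ ≤ 1 := by linarith
  have hpow : 0 < (1 - Δ) ^ m := pow_pos hx0 m
  have hw : ∀ k, 0 ≤ (n.choose k : ℝ) * γ ^ k * (1 - γ) ^ (n - k) := fun k => by
    have : 0 ≤ 1 - γ := by linarith
    positivity
  have h1 : (∑ k ∈ Finset.range (n + 1),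
        (n.choose k : ℝ) * γ ^ k * (1 - γ) ^ (n - k) * (if k ≤ m then 1 else 0)) * (1 - Δ) ^ m
      ≤ (1 - γ * (1 - (1 - Δ))) ^ n := by
    rw [← aux_binom, Finset.sum_mul]
    refine Finset.sum_le_sum fun k _ => ?_
    rw [mul_assoc]
    refine mul_le_mul_of_nonneg_left ?_ (hw k)
    split_ifs with hk
    · rw [one_mul]; exact pow_le_pow_of_le_one hx0.le hx1 hk
    · rw [zero_mul]; positivity
  have h2 : (1 - γ * (1 - (1 - Δ))) ^ n ≤ Real.exp (-(n * (γ * Δ))) := by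
    have e : 1 - γ * (1 - (1 - Δ)) = 1 - γ * Δ := by ring
    have h0 : 0 ≤ 1 - γ * Δ := by nlinarith
    have h3 := pow_le_pow_left₀ h0 (Real.one_sub_le_exp_neg (γ * Δ)) n
    rw [← Real.exp_nat_mul] at h3
    rw [e]
    refine h3.trans (le_of_eq ?_)
    congr 1; ring
  have h3 : Real.exp (-(n * (γ * Δ))) ≤ Real.exp (-Δ ^ 2 * (n : ℝ) * γ / 2) * (1 - Δ) ^ m := by
    have e : (1 - Δ) ^ m = Real.exp (m * Real.log (1 - Δ)) := by
      rw [Real.exp_nat_mul, Real.exp_log hx0]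
    rw [e, ← Real.exp_add, Real.exp_le_exp, hm]
    have h4 := aux_x_log hx0 hx1
    have h5 : 0 ≤ (n : ℝ) * γ := by positivity
    have h6 := mul_le_mul_of_nonneg_left h4 h5
    nlinarith
  exact le_of_mul_le_mul_right (h1.trans (h2.trans h3)) hpow

lemma aux_kbar_mono (ε0 : ℝ) {a b : ℕ} (h : a ≤ b) : kbar ε0 a ≤ kbar ε0 b := by
  unfold kbar
  gcongr

lemma aux_ups_coef (ε0 γ : ℝ) (hε0 : 0 ≤ ε0) (hγ0 : 0 < γ) (lam : ℕ) :
    0 ≤ (1 + γ * (Real.exp (2 * ε0) - 1) / Real.exp ε0) ^ lam - 1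
      - (lam : ℝ) * γ * (Real.exp (2 * ε0) - 1) / Real.exp ε0 := by
  have h1 : 0 ≤ Real.exp (2 * ε0) - 1 := by
    have := Real.one_le_exp (x := 2 * ε0) (by linarith)
    linarith
  have h2 : 0 ≤ γ * (Real.exp (2 * ε0) - 1) / Real.exp ε0 := by positivity
  have h3 := one_add_mul_le_pow (a := γ * (Real.exp (2 * ε0) - 1) / Real.exp ε0)
    (by linarith) lam
  have e : (lam : ℝ) * γ * (Real.exp (2 * ε0) - 1) / Real.exp ε0
     = lam * (γ * (Real.exp (2 * ε0) - 1) / Real.exp ε0) := by ring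
  rw [e]; linarith

lemma aux_gamma_nonneg (j : ℕ) : 0 ≤ Real.Gamma ((j : ℝ) / 2) :=
  Real.Gamma_nonneg_of_nonneg (by positivity)

lemma aux_F_anti (ε0 γ : ℝ) (hε0 : 0 ≤ ε0) (hγ0 : 0 < γ) (lam : ℕ) {a b : ℕ} (h : a ≤ b) :
    Fbound ε0 γ lam b ≤ Fbound ε0 γ lam a := by
  have hk : (kbar ε0 a : ℝ) ≤ kbar ε0 b := by exact_mod_cast aux_kbar_mono ε0 h
  have hk0 : (0 : ℝ) < kbar ε0 a := by unfold kbar; positivity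
  have hc := aux_ups_coef ε0 γ hε0 hγ0 lam
  have hab : (a : ℝ) ≤ b := by exact_mod_cast h
  unfold Fbound
  refine add_le_add (add_le_add (add_le_add le_rfl ?_) (Finset.sum_le_sum fun j _ => ?_)) ?_
  · gcongr
  · have := aux_gamma_nonneg j
    have hk1 : (0 : ℝ) < kbar ε0 b := hk0.trans_le hk
    refine mul_le_mul_of_nonneg_left ?_ (by positivity)
    refine Real.rpow_le_rpow (by positivity) ?_ (by positivity)
    gcongr
  · unfold Upsilon
    refine mul_le_mul_of_nonneg_left ?_ hc
    rw [Real.exp_le_exp]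
    gcongr

lemma aux_F_one_le (ε0 γ : ℝ) (hε0 : 0 ≤ ε0) (hγ0 : 0 < γ) (lam : ℕ) (k : ℕ) :
    1 ≤ Fbound ε0 γ lam k := by
  have hc := aux_ups_coef ε0 γ hε0 hγ0 lam
  unfold Fbound
  have h1 : 0 ≤ 4 * (lam.choose 2 : ℝ) * γ ^ 2 * (Real.exp ε0 - 1) ^ 2
        / ((kbar ε0 k : ℝ) * Real.exp ε0) := by positivity
  have h2 : 0 ≤ ∑ j ∈ Finset.Icc 3 lam,
        (lam.choose j : ℝ) * γ ^ j * (j : ℝ) * Real.Gamma ((j : ℝ) / 2)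
          * (2 * (Real.exp (2 * ε0) - 1) ^ 2 / ((kbar ε0 k : ℝ) * Real.exp (2 * ε0)))
              ^ ((j : ℝ) / 2) := by
    refine Finset.sum_nonneg fun j _ => ?_
    have := aux_gamma_nonneg j
    positivity
  have h3 : 0 ≤ Upsilon ε0 γ lam k := by
    unfold Upsilon
    exact mul_nonneg hc (Real.exp_pos _).le
  linarith

/-- Theorem 3.2 (analytic core of the RDP upper bound for shuffled check-in). -/
theorem shuffled_check_in_rdp_upper_bound
    (n : ℕ) (ε0 γ Δ : ℝ) (hε0 : 0 ≤ ε0) (hγ0 : 0 < γ) (hγ1 : γ ≤ 1)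
    (hΔ0 : 0 ≤ Δ) (hΔ1 : Δ ≤ 1) (lam : ℕ) (hlam : 2 ≤ lam)
    (m : ℕ) (hm : (m : ℝ) = (1 - Δ) * (n : ℝ) * γ) (hm0 : 0 < m) (hmn : m < n) :
    ∑ k ∈ Finset.range (n + 1),
        (n.choose k : ℝ) * γ ^ k * (1 - γ) ^ (n - k)
          * (if k = 0 then 1 else Fbound ε0 γ lam k)
      ≤ 1 + 4 * (lam.choose 2 : ℝ) * γ ^ 2 * (Real.exp ε0 - 1) ^ 2
              * (Real.exp (-ε0 - Δ ^ 2 * (n : ℝ) * γ / 2)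
                  + Real.exp (-ε0) / (ltilde ε0 γ Δ n : ℝ))
          + ∑ j ∈ Finset.Icc 3 lam,
              (lam.choose j : ℝ) * γ ^ j * (j : ℝ) * Real.Gamma ((j : ℝ) / 2)
                * (2 * (Real.exp (2 * ε0) - 1) ^ 2 / Real.exp (2 * ε0)) ^ ((j : ℝ) / 2)
                * (Real.exp (-Δ ^ 2 * (n : ℝ) * γ / 2)
                    + (ltilde ε0 γ Δ n : ℝ) ^ (-(j : ℝ) / 2))
          + Upsilon ε0 γ lam 1 * Real.exp (-Δ ^ 2 * (n : ℝ) * γ / 2)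
          + Upsilon ε0 γ lam (m + 1) := by
  have hΔ : Δ < 1 := by
    rcases hΔ1.lt_or_eq with h | h
    · exact h
    · subst h
      have : (m : ℝ) = 0 := by rw [hm]; ring
      have : m = 0 := by exact_mod_cast this
      omega
  have hP := aux_chernoff n γ Δ hγ0 hγ1 hΔ0 hΔ m hm
  have hw : ∀ k, 0 ≤ (n.choose k : ℝ) * γ ^ k * (1 - γ) ^ (n - k) := fun k => by
    have : 0 ≤ 1 - γ := by linarith
    positivity
  have hsum : ∑ k ∈ Finset.range (n + 1), (n.choose k : ℝ) * γ ^ k * (1 - γ) ^ (n - k) = 1 := by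
    have := aux_binom n γ 1
    simpa using this
  have hF1 := aux_F_one_le ε0 γ hε0 hγ0 lam 1
  have hFm := aux_F_one_le ε0 γ hε0 hγ0 lam (m + 1)
  have hmain : ∑ k ∈ Finset.range (n + 1),
        (n.choose k : ℝ) * γ ^ k * (1 - γ) ^ (n - k)
          * (if k = 0 then 1 else Fbound ε0 γ lam k)
      ≤ Fbound ε0 γ lam (m + 1)
        + (Fbound ε0 γ lam 1 - 1) * Real.exp (-Δ ^ 2 * (n : ℝ) * γ / 2) := by
    calc _ ≤ ∑ k ∈ Finset.range (n + 1), ((n.choose k : ℝ) * γ ^ k * (1 - γ) ^ (n - k)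
              * Fbound ε0 γ lam (m + 1) + (Fbound ε0 γ lam 1 - 1) *
              ((n.choose k : ℝ) * γ ^ k * (1 - γ) ^ (n - k) * (if k ≤ m then 1 else 0))) := by
          refine Finset.sum_le_sum fun k _ => ?_
          have key : (if k = 0 then 1 else Fbound ε0 γ lam k) ≤ Fbound ε0 γ lam (m + 1)
              + (Fbound ε0 γ lam 1 - 1) * (if k ≤ m then 1 else 0) := by
            by_cases hk0 : k = 0
            · subst hk0
              simp only [if_true, Nat.zero_le]
              linarith
            · rw [if_neg hk0]
              by_cases hkm : k ≤ m
              · rw [if_pos hkm]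
                have := aux_F_anti ε0 γ hε0 hγ0 lam (a := 1) (b := k) (by omega)
                linarith
              · rw [if_neg hkm]
                have := aux_F_anti ε0 γ hε0 hγ0 lam (a := m + 1) (b := k) (by omega)
                linarith
          have := mul_le_mul_of_nonneg_left key (hw k)
          refine this.trans (le_of_eq ?_)
          ring
      _ ≤ _ := by
          rw [Finset.sum_add_distrib, ← Finset.sum_mul, ← Finset.mul_sum, hsum, one_mul]
          gcongr
  refine hmain.trans (le_of_eq ?_)
  have hk1 : kbar ε0 1 = 1 := by simp [kbar]
  have hkm : kbar ε0 (m + 1) = ltilde ε0 γ Δ n := by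
    simp [kbar, ltilde, hm]
  have hl0 : (0 : ℝ) < ltilde ε0 γ Δ n := by unfold ltilde; positivity
  have hS : ∑ j ∈ Finset.Icc 3 lam,
              (lam.choose j : ℝ) * γ ^ j * (j : ℝ) * Real.Gamma ((j : ℝ) / 2)
                * (2 * (Real.exp (2 * ε0) - 1) ^ 2 / Real.exp (2 * ε0)) ^ ((j : ℝ) / 2)
                * (Real.exp (-Δ ^ 2 * (n : ℝ) * γ / 2)
                    + (ltilde ε0 γ Δ n : ℝ) ^ (-(j : ℝ) / 2))
      = (∑ j ∈ Finset.Icc 3 lam,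
        (lam.choose j : ℝ) * γ ^ j * (j : ℝ) * Real.Gamma ((j : ℝ) / 2)
          * (2 * (Real.exp (2 * ε0) - 1) ^ 2 / Real.exp (2 * ε0)) ^ ((j : ℝ) / 2))
            * Real.exp (-Δ ^ 2 * (n : ℝ) * γ / 2)
        + ∑ j ∈ Finset.Icc 3 lam,
        (lam.choose j : ℝ) * γ ^ j * (j : ℝ) * Real.Gamma ((j : ℝ) / 2)
          * (2 * (Real.exp (2 * ε0) - 1) ^ 2 / ((ltilde ε0 γ Δ n : ℝ) * Real.exp (2 * ε0)))
              ^ ((j : ℝ) / 2) := by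
    rw [Finset.sum_mul, ← Finset.sum_add_distrib]
    refine Finset.sum_congr rfl fun j _ => ?_
    have e : 2 * (Real.exp (2 * ε0) - 1) ^ 2 / ((ltilde ε0 γ Δ n : ℝ) * Real.exp (2 * ε0))
      = (2 * (Real.exp (2 * ε0) - 1) ^ 2 / Real.exp (2 * ε0)) / (ltilde ε0 γ Δ n : ℝ) := by
      field_simp
    rw [e, Real.div_rpow (by positivity) hl0.le, neg_div, Real.rpow_neg hl0.le]
    ring
  have hE : Real.exp (-ε0 - Δ ^ 2 * (n : ℝ) * γ / 2)
      = (Real.exp ε0)⁻¹ * Real.exp (-Δ ^ 2 * (n : ℝ) * γ / 2) := by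
    rw [← Real.exp_neg, ← Real.exp_add]
    congr 1; ring
  rw [hS, hE, Real.exp_neg]
  unfold Fbound
  rw [hk1, hkm]
  simp only [Nat.cast_one, one_mul]
  have e2 : 4 * (lam.choose 2 : ℝ) * γ ^ 2 * (Real.exp ε0 - 1) ^ 2
      / ((ltilde ε0 γ Δ n : ℝ) * Real.exp ε0) = 4 * (lam.choose 2 : ℝ) * γ ^ 2
      * (Real.exp ε0 - 1) ^ 2 * ((Real.exp ε0)⁻¹ / (ltilde ε0 γ Δ n : ℝ)) := by
    field_simp
  rw [e2]
  ring
end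

section
/- Monotonicity lemma (Appendix A.1). Fix reals ε0 ≥ 0 and γ ∈ [0,1] and an integer λ ≥ 2. Then the function k ↦ F(k), defined for integers k ≥ 1 as in the context, is monotonically nonincreasing in k: for all integers 1 ≤ k ≤ k', F(k') ≤ F(k). -/
open Finset

/-- Monotonicity lemma (Appendix A.1): `k ↦ F(k)` is nonincreasing for `k ≥ 1`. -/
theorem Fbound_antitone
    (ε0 γ : ℝ) (hε0 : 0 ≤ ε0) (hγ0 : 0 ≤ γ) (hγ1 : γ ≤ 1)
    (lam : ℕ) (hlam : 2 ≤ lam) :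
    ∀ k k' : ℕ, 1 ≤ k → k ≤ k' → Fbound ε0 γ lam k' ≤ Fbound ε0 γ lam k := by
  intro k k' hk hkk
  have hkk' : (k : ℝ) ≤ (k' : ℝ) := by exact_mod_cast hkk
  have hE : 0 < Real.exp ε0 := Real.exp_pos ε0
  have hE2 : 0 < Real.exp (2 * ε0) := Real.exp_pos _
  have hb : (kbar ε0 k : ℝ) ≤ (kbar ε0 k' : ℝ) := by
    have : kbar ε0 k ≤ kbar ε0 k' := by
      unfold kbar
      apply Nat.succ_le_succ
      apply Nat.floor_le_floor
      gcongr
    exact_mod_cast this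
  have hb0 : (0 : ℝ) < (kbar ε0 k : ℝ) := by
    have : 0 < kbar ε0 k := Nat.succ_pos _
    exact_mod_cast this
  have hx : 0 ≤ γ * (Real.exp (2 * ε0) - 1) / Real.exp ε0 := by
    have h1 : 1 ≤ Real.exp (2 * ε0) := Real.one_le_exp (by linarith)
    exact div_nonneg (mul_nonneg hγ0 (by linarith)) hE.le
  have hbern := one_add_mul_le_pow
    (a := γ * (Real.exp (2 * ε0) - 1) / Real.exp ε0) (by linarith) lam
  have hU : Upsilon ε0 γ lam k' ≤ Upsilon ε0 γ lam k := by
    unfold Upsilon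
    apply mul_le_mul_of_nonneg_left
    · apply Real.exp_le_exp.mpr
      gcongr
    · have e : (lam : ℝ) * γ * (Real.exp (2 * ε0) - 1) / Real.exp ε0
          = (lam : ℝ) * (γ * (Real.exp (2 * ε0) - 1) / Real.exp ε0) := by ring
      rw [e]
      linarith
  unfold Fbound
  refine add_le_add (add_le_add (add_le_add le_rfl ?_) (Finset.sum_le_sum ?_)) hU
  · apply div_le_div_of_nonneg_left
    · positivity
    · positivity
    · gcongr
  · intro j hj
    have hj3 : 3 ≤ j := (Finset.mem_Icc.mp hj).1
    have hj0 : (0 : ℝ) < (j : ℝ) := by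
      have : 0 < j := by omega
      exact_mod_cast this
    have hG : 0 < Real.Gamma ((j : ℝ) / 2) := Real.Gamma_pos_of_pos (by positivity)
    apply mul_le_mul_of_nonneg_left
    · apply Real.rpow_le_rpow
      · positivity
      · apply div_le_div_of_nonneg_left
        · positivity
        · positivity
        · gcongr
      · positivity
    · positivity
end

section
/- Likelihood ratio identity for shuffled binary randomized response. Fix a real ε0 ≥ 0 and let k ≥ 1 be an integer. Then for every m ∈ {0,1,…,k}, μ1(m) = ( (m/k)·e^{ε0} + ((k−m)/k)·e^{−ε0} ) · μ0(m); equivalently, since μ0(m) > 0, μ1(m)/μ0(m) = (m/k) e^{ε0} + ((k−m)/k) e^{−ε0}. -/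
open Finset

/-- `ρ = 1/(e^{ε0}+1)`. -/
noncomputable def rho (ε0 : ℝ) : ℝ := 1 / (Real.exp ε0 + 1)

/-- Distribution of the number of ones output by the shuffled `ε0`-LDP binary randomized
response applied to the all-zeros database: `μ0(m) = C(k,m) ρ^m (1−ρ)^{k−m}`. -/
noncomputable def mu0 (ε0 : ℝ) (k m : ℕ) : ℝ :=
  (k.choose m : ℝ) * rho ε0 ^ m * (1 - rho ε0) ^ (k - m)

/-- Distribution of the number of ones for the adjacent database with one entry equal to 1:
`μ1(m) = (1−ρ)·C(k−1,m−1) ρ^{m−1} (1−ρ)^{k−m} + ρ·C(k−1,m) ρ^m (1−ρ)^{k−m−1}`,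
with the conventions `C(k−1,−1) = C(k−1,k) = 0`. -/
noncomputable def mu1 (ε0 : ℝ) (k m : ℕ) : ℝ :=
  (if m = 0 then 0 else
    (1 - rho ε0) * ((k - 1).choose (m - 1) : ℝ) * rho ε0 ^ (m - 1) * (1 - rho ε0) ^ (k - m))
  + rho ε0 * ((k - 1).choose m : ℝ) * rho ε0 ^ m * (1 - rho ε0) ^ (k - m - 1)

/-- `q_k(m) = μ0(m)`. -/
noncomputable def qDist (ε0 : ℝ) (k m : ℕ) : ℝ := mu0 ε0 k m

/-- `p_k(m) = (1−γ) μ0(m) + γ μ1(m)`. -/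
noncomputable def pDist (ε0 γ : ℝ) (k m : ℕ) : ℝ :=
  (1 - γ) * mu0 ε0 k m + γ * mu1 ε0 k m

/-- Likelihood ratio identity for the shuffled binary randomized response. -/
theorem mu1_eq_ratio_mul_mu0
    (ε0 : ℝ) (hε0 : 0 ≤ ε0) (k : ℕ) (hk : 1 ≤ k) (m : ℕ) (hm : m ≤ k) :
    mu1 ε0 k m
        = (((m : ℝ) / k) * Real.exp ε0 + (((k : ℝ) - m) / k) * Real.exp (-ε0)) * mu0 ε0 k m
      ∧ 0 < mu0 ε0 k m
      ∧ mu1 ε0 k m / mu0 ε0 k m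
          = ((m : ℝ) / k) * Real.exp ε0 + (((k : ℝ) - m) / k) * Real.exp (-ε0) := by
  have hE : 0 < Real.exp ε0 := Real.exp_pos _
  have hr : 0 < rho ε0 := by unfold rho; positivity
  have hsE : 1 - rho ε0 = Real.exp ε0 * rho ε0 := by
    unfold rho; field_simp; ring
  have hs : 0 < 1 - rho ε0 := by rw [hsE]; positivity
  have hEs : Real.exp (-ε0) * (1 - rho ε0) = rho ε0 := by
    rw [hsE, ← mul_assoc, ← Real.exp_add]; simp
  have hpos : 0 < mu0 ε0 k m := by
    have : 0 < (k.choose m : ℝ) := by exact_mod_cast Nat.choose_pos hm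
    unfold mu0; positivity
  have main : mu1 ε0 k m
        = (((m : ℝ) / k) * Real.exp ε0 + (((k : ℝ) - m) / k) * Real.exp (-ε0))
          * mu0 ε0 k m := by
    unfold mu1 mu0
    generalize rho ε0 = r at *
    generalize 1 - r = s at *
    generalize Real.exp ε0 = E at *
    generalize Real.exp (-ε0) = F at *
    obtain ⟨n, rfl⟩ : ∃ n, k = n + 1 := ⟨k - 1, by omega⟩
    have hn : ((n + 1 : ℕ) : ℝ) ≠ 0 := by positivity
    rw [add_mul]
    congr 1
    · rcases m with _ | j
      · simp
      · have h : ((n + 1 : ℕ) : ℝ) * (n.choose j : ℝ)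
            = ((n + 1).choose (j + 1) : ℝ) * ((j + 1 : ℕ) : ℝ) := by
          exact_mod_cast Nat.add_one_mul_choose_eq n j
        simp only [Nat.add_sub_cancel, Nat.add_eq_zero_iff, one_ne_zero, and_false, if_false]
        generalize s ^ (n + 1 - (j + 1)) = P
        generalize ((n + 1 : ℕ) : ℝ) = K at *
        rw [div_mul_eq_mul_div, div_mul_eq_mul_div, eq_div_iff hn, hsE, pow_succ]
        linear_combination (E * r * r ^ j * P) * h
    · rcases hm.eq_or_lt with rfl | hlt
      · simp
      · obtain ⟨d, rfl⟩ : ∃ d, n = m + d := ⟨n - m, by omega⟩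
        have h : (((m + d).choose m : ℕ) : ℝ) * ((m + d + 1 : ℕ) : ℝ)
            = ((m + d + 1).choose m : ℝ) * ((d + 1 : ℕ) : ℝ) := by
          have := Nat.choose_mul_succ_eq (m + d) m
          rw [show m + d + 1 - m = d + 1 by omega] at this
          exact_mod_cast this
        have e : (((m + d + 1 : ℕ) : ℝ) - m) = ((d + 1 : ℕ) : ℝ) := by push_cast; ring
        rw [e, show m + d + 1 - m - 1 = d by omega, show m + d + 1 - m = d + 1 by omega,
          Nat.add_sub_cancel]
        generalize ((m + d + 1 : ℕ) : ℝ) = K at *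
        rw [div_mul_eq_mul_div, div_mul_eq_mul_div, eq_div_iff hn, pow_succ, ← hEs]
        linear_combination (F * s * (F * s) ^ m * s ^ d) * h
  exact ⟨main, hpos, by rw [main, mul_div_assoc, div_self hpos.ne', mul_one]⟩
end

section
/- Centered ratio identity for subsampled shuffled binary randomized response. Fix a real ε0 ≥ 0, an integer k ≥ 1, and γ ∈ [0,1]. Then for every m ∈ {0,1,…,k}, p_k(m) = q_k(m) · ( 1 + γ · (e^{2ε0}−1)/(k e^{ε0}) · ( m − k/(e^{ε0}+1) ) ); equivalently, p_k(m)/q_k(m) − 1 = γ · (e^{2ε0}−1)/(k e^{ε0}) · ( m − k/(e^{ε0}+1) ). -/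
open Finset

lemma mu1_eq_aux (ε0 : ℝ) (k m : ℕ) (hk : 1 ≤ k) (hm : m ≤ k) :
    (k : ℝ) * mu1 ε0 k m
      = mu0 ε0 k m * (Real.exp ε0 * m + ((k : ℝ) - m) / Real.exp ε0) := by
  have hE : 0 < Real.exp ε0 := Real.exp_pos ε0
  have h1 : 1 - rho ε0 = Real.exp ε0 * rho ε0 := by
    unfold rho; field_simp; ring
  have h2 : rho ε0 = (1 - rho ε0) / Real.exp ε0 := by
    rw [h1]; field_simp
  obtain ⟨n, rfl⟩ : ∃ n, k = n + 1 := ⟨k - 1, by omega⟩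
  have t1 : ((n + 1 : ℕ) : ℝ) * (if m = 0 then 0 else
      (1 - rho ε0) * ((n + 1 - 1).choose (m - 1) : ℝ) * rho ε0 ^ (m - 1)
        * (1 - rho ε0) ^ (n + 1 - m)) = mu0 ε0 (n + 1) m * (Real.exp ε0 * m) := by
    rcases m with _ | j
    · simp
    · have hc : ((n + 1 : ℕ) : ℝ) * (n.choose j : ℝ)
          = ((n + 1).choose (j + 1) : ℝ) * ((j + 1 : ℕ) : ℝ) := by
        exact_mod_cast Nat.add_one_mul_choose_eq n j
      rw [if_neg (Nat.succ_ne_zero j)]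
      simp only [Nat.add_sub_cancel]
      unfold mu0
      calc _ = (((n + 1 : ℕ) : ℝ) * (n.choose j : ℝ)) * (1 - rho ε0) * rho ε0 ^ j
              * (1 - rho ε0) ^ (n + 1 - (j + 1)) := by ring
        _ = (((n + 1 : ℕ) : ℝ) * (n.choose j : ℝ)) * (Real.exp ε0 * rho ε0) * rho ε0 ^ j
              * (1 - rho ε0) ^ (n + 1 - (j + 1)) := by
            congr 3
        _ = _ := by rw [hc, pow_succ]; ring
  have t2 : ((n + 1 : ℕ) : ℝ) * (rho ε0 * ((n + 1 - 1).choose m : ℝ) * rho ε0 ^ m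
      * (1 - rho ε0) ^ (n + 1 - m - 1))
      = mu0 ε0 (n + 1) m * ((((n + 1 : ℕ) : ℝ) - m) / Real.exp ε0) := by
    rcases Nat.lt_or_ge n m with h | h
    · have : m = n + 1 := by omega
      subst this
      simp
    · have hc : ((n + 1 : ℕ) : ℝ) * (n.choose m : ℝ)
          = ((n + 1).choose m : ℝ) * (((n + 1 : ℕ) : ℝ) - m) := by
        rw [← Nat.cast_sub hm, mul_comm]
        exact_mod_cast Nat.choose_mul_succ_eq n m
      have hs : n + 1 - m = (n - m) + 1 := by omega
      unfold mu0
      simp only [Nat.add_sub_cancel, hs]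
      calc _ = (((n + 1 : ℕ) : ℝ) * (n.choose m : ℝ)) * rho ε0 * rho ε0 ^ m
              * (1 - rho ε0) ^ (n - m) := by ring
        _ = (((n + 1 : ℕ) : ℝ) * (n.choose m : ℝ)) * ((1 - rho ε0) / Real.exp ε0) * rho ε0 ^ m
              * (1 - rho ε0) ^ (n - m) := by
            congr 3
        _ = _ := by rw [hc, pow_succ]; ring
  unfold mu1
  rw [mul_add, t1, t2]; ring

lemma mu0_pos_aux (ε0 : ℝ) (k m : ℕ) (hm : m ≤ k) : 0 < mu0 ε0 k m := by
  have hE : 0 < Real.exp ε0 := Real.exp_pos ε0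
  have h0 : 0 < rho ε0 := by unfold rho; positivity
  have h1 : 1 - rho ε0 = Real.exp ε0 * rho ε0 := by
    unfold rho; field_simp; ring
  have hc : (0 : ℝ) < (k.choose m : ℝ) := by exact_mod_cast Nat.choose_pos hm
  unfold mu0
  rw [h1]
  positivity

/-- Centered ratio identity for the subsampled shuffled binary randomized response. -/
theorem pDist_centered_ratio
    (ε0 : ℝ) (hε0 : 0 ≤ ε0) (k : ℕ) (hk : 1 ≤ k) (γ : ℝ) (hγ0 : 0 ≤ γ) (hγ1 : γ ≤ 1)
    (m : ℕ) (hm : m ≤ k) :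
    pDist ε0 γ k m
        = qDist ε0 k m * (1 + γ * (Real.exp (2 * ε0) - 1) / ((k : ℝ) * Real.exp ε0)
            * ((m : ℝ) - (k : ℝ) / (Real.exp ε0 + 1)))
      ∧ pDist ε0 γ k m / qDist ε0 k m - 1
          = γ * (Real.exp (2 * ε0) - 1) / ((k : ℝ) * Real.exp ε0)
              * ((m : ℝ) - (k : ℝ) / (Real.exp ε0 + 1)) := by
  have hE : 0 < Real.exp ε0 := Real.exp_pos ε0
  have hkr : (0 : ℝ) < k := by exact_mod_cast hk
  have hq := mu0_pos_aux ε0 k m hm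
  have hmain : pDist ε0 γ k m
        = qDist ε0 k m * (1 + γ * (Real.exp (2 * ε0) - 1) / ((k : ℝ) * Real.exp ε0)
            * ((m : ℝ) - (k : ℝ) / (Real.exp ε0 + 1))) := by
    have h := mu1_eq_aux ε0 k m hk hm
    have h' : mu1 ε0 k m
        = mu0 ε0 k m * (Real.exp ε0 * m + ((k : ℝ) - m) / Real.exp ε0) / k := by
      rw [← h]; field_simp
    have h2 : Real.exp (2 * ε0) = Real.exp ε0 ^ 2 := by
      rw [two_mul, Real.exp_add, sq]
    unfold pDist qDist
    rw [h', h2]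
    field_simp
    ring
  refine ⟨hmain, ?_⟩
  have hq' : qDist ε0 k m ≠ 0 := hq.ne'
  rw [hmain, mul_div_cancel_left₀ _ hq']
  ring
end

section
/- Moment expansion for subsampled shuffled binary randomized response. Fix a real ε0 ≥ 0, an integer k ≥ 1, γ ∈ [0,1], and an integer λ ≥ 2. Then Σ_{m=0}^{k} μ0(m) · ( p_k(m)/q_k(m) )^λ = 1 + C(λ,2) · γ² · (e^{ε0}−1)² / (k e^{ε0}) + Σ_{j=3}^{λ} C(λ,j) · γ^j · ( (e^{2ε0}−1)/(k e^{ε0}) )^j · Σ_{m=0}^{k} μ0(m) · ( m − k/(e^{ε0}+1) )^j. In particular the j = 1 term vanishes and the j = 2 term equals C(λ,2) γ² (e^{ε0}−1)²/(k e^{ε0}), since the mean and variance of μ0 are kρ = k/(e^{ε0}+1) and kρ(1−ρ) = k e^{ε0}/(e^{ε0}+1)². -/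
open Finset

lemma rho_ne (ε0 : ℝ) : rho ε0 ≠ 0 := by
  unfold rho; have := Real.exp_pos ε0; positivity

lemma one_sub_rho (ε0 : ℝ) : 1 - rho ε0 = Real.exp ε0 * rho ε0 := by
  unfold rho; have := Real.exp_pos ε0; field_simp; ring

lemma mu0_ne (ε0 : ℝ) (k m : ℕ) (h : m ≤ k) : mu0 ε0 k m ≠ 0 := by
  unfold mu0
  have h1 : (k.choose m : ℝ) ≠ 0 := by
    exact_mod_cast (Nat.choose_pos h).ne'
  have h2 := rho_ne ε0
  have h3 : 1 - rho ε0 ≠ 0 := by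
    rw [one_sub_rho]; exact mul_ne_zero (Real.exp_pos ε0).ne' h2
  positivity

lemma mu0_eval (ε0 : ℝ) (k m : ℕ) :
    mu0 ε0 k m = (bernsteinPolynomial ℝ k m).eval (rho ε0) := by
  simp [mu0, bernsteinPolynomial]

lemma mu0_sum (ε0 : ℝ) (k : ℕ) : ∑ m ∈ Finset.range (k + 1), mu0 ε0 k m = 1 := by
  have := congrArg (Polynomial.eval (rho ε0)) (bernsteinPolynomial.sum ℝ k)
  simpa [Polynomial.eval_finset_sum, ← mu0_eval] using this

lemma mu0_mean (ε0 : ℝ) (k : ℕ) :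
    ∑ m ∈ Finset.range (k + 1), mu0 ε0 k m * ((m : ℝ) - (k : ℝ) / (Real.exp ε0 + 1)) = 0 := by
  have := congrArg (Polynomial.eval (rho ε0)) (bernsteinPolynomial.sum_smul ℝ k)
  simp only [Polynomial.eval_finset_sum, nsmul_eq_mul, Polynomial.eval_mul,
    Polynomial.eval_natCast, Polynomial.eval_X, ← mu0_eval] at this
  simp only [mul_sub, Finset.sum_sub_distrib, ← Finset.sum_mul, mu0_sum]
  simp only [mul_comm (mu0 _ _ _), this, rho]
  ring

lemma mu0_var (ε0 : ℝ) (k : ℕ) :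
    ∑ m ∈ Finset.range (k + 1), mu0 ε0 k m * ((m : ℝ) - (k : ℝ) / (Real.exp ε0 + 1)) ^ 2
      = (k : ℝ) * Real.exp ε0 / (Real.exp ε0 + 1) ^ 2 := by
  have := congrArg (Polynomial.eval (rho ε0)) (bernsteinPolynomial.variance ℝ k)
  simp only [Polynomial.eval_finset_sum, nsmul_eq_mul, Polynomial.eval_mul, Polynomial.eval_sub,
    Polynomial.eval_pow, Polynomial.eval_one,
    Polynomial.eval_natCast, Polynomial.eval_X, ← mu0_eval] at this
  rw [one_sub_rho] at this
  have e : (k : ℝ) * Real.exp ε0 / (Real.exp ε0 + 1) ^ 2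
      = k * rho ε0 * (Real.exp ε0 * rho ε0) := by
    unfold rho; have := Real.exp_pos ε0; field_simp
  rw [e, ← this]
  refine Finset.sum_congr rfl fun m _ => ?_
  unfold rho; ring

lemma mu1_eq (ε0 : ℝ) (k m : ℕ) (hk : 1 ≤ k) (h : m ≤ k) :
    mu1 ε0 k m = mu0 ε0 k m * (1 + ((Real.exp (2 * ε0) - 1) / ((k : ℝ) * Real.exp ε0))
      * ((m : ℝ) - (k : ℝ) / (Real.exp ε0 + 1))) := by
  have hE := Real.exp_pos ε0
  have h2 : Real.exp (2 * ε0) = Real.exp ε0 ^ 2 := by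
    rw [← Real.exp_nat_mul]; norm_num
  have hr := rho_ne ε0
  have hk0 : (k : ℝ) ≠ 0 := by positivity
  have hA : (if m = 0 then 0 else
      (1 - rho ε0) * ((k - 1).choose (m - 1) : ℝ) * rho ε0 ^ (m - 1) * (1 - rho ε0) ^ (k - m))
      = mu0 ε0 k m * (Real.exp ε0 * m / k) := by
    rcases m with _ | m
    · simp
    · obtain ⟨n, rfl⟩ : ∃ n, k = n + 1 := ⟨k - 1, by omega⟩
      have hc : ((n : ℝ) + 1) * (n.choose m : ℝ) = ((n + 1).choose (m + 1) : ℝ) * (m + 1) := by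
        exact_mod_cast Nat.add_one_mul_choose_eq n m
      have hn : (n : ℝ) + 1 ≠ 0 := by positivity
      have hc' : (n.choose m : ℝ) = ((n + 1).choose (m + 1) : ℝ) * (m + 1) / (n + 1) := by
        rw [← hc]; field_simp
      simp only [mu0, Nat.add_sub_cancel, Nat.succ_ne_zero, if_false, hc']
      generalize hx : (1 - rho ε0) ^ (n + 1 - (m + 1)) = x
      rw [one_sub_rho]
      push_cast
      ring
  have hB : rho ε0 * ((k - 1).choose m : ℝ) * rho ε0 ^ m * (1 - rho ε0) ^ (k - m - 1)
      = mu0 ε0 k m * ((k - m) / (k * Real.exp ε0)) := by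
    obtain ⟨n, rfl⟩ : ∃ n, k = n + 1 := ⟨k - 1, by omega⟩
    rcases h.eq_or_lt with rfl | h
    · simp
    · obtain ⟨d, rfl⟩ : ∃ d, n = m + d := ⟨n - m, by omega⟩
      have hc : ((m + d).choose m : ℝ) * ((m : ℝ) + d + 1)
          = ((m + d + 1).choose m : ℝ) * (d + 1) := by
        have := Nat.choose_mul_succ_eq (m + d) m
        rw [show m + d + 1 - m = d + 1 by omega] at this
        exact_mod_cast this
      have hn : (m : ℝ) + d + 1 ≠ 0 := by positivity
      have hc' : ((m + d).choose m : ℝ)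
          = ((m + d + 1).choose m : ℝ) * (d + 1) / ((m : ℝ) + d + 1) := by
        rw [← hc]; field_simp
      simp only [mu0, Nat.add_sub_cancel, show m + d + 1 - m = d + 1 by omega, hc', pow_succ]
      generalize hx : (1 - rho ε0) ^ d = x
      rw [one_sub_rho]
      push_cast
      field_simp
      ring
  unfold mu1
  rw [hA, hB, ← mul_add, h2]
  congr 1
  field_simp
  ring

/-- Moment expansion for the subsampled shuffled binary randomized response.  The `j = 1`
central moment of `μ0` vanishes and the second central moment is `kρ(1−ρ) = k e^{ε0}/(e^{ε0}+1)²`,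
giving the displayed `j = 2` term. -/
theorem moment_expansion
    (ε0 : ℝ) (hε0 : 0 ≤ ε0) (k : ℕ) (hk : 1 ≤ k) (γ : ℝ) (hγ0 : 0 ≤ γ) (hγ1 : γ ≤ 1)
    (lam : ℕ) (hlam : 2 ≤ lam) :
    (∑ m ∈ Finset.range (k + 1),
        mu0 ε0 k m * (pDist ε0 γ k m / qDist ε0 k m) ^ lam)
        = 1 + (lam.choose 2 : ℝ) * γ ^ 2 * (Real.exp ε0 - 1) ^ 2 / ((k : ℝ) * Real.exp ε0)
          + ∑ j ∈ Finset.Icc 3 lam,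
              (lam.choose j : ℝ) * γ ^ j
                * ((Real.exp (2 * ε0) - 1) / ((k : ℝ) * Real.exp ε0)) ^ j
                * ∑ m ∈ Finset.range (k + 1),
                    mu0 ε0 k m * ((m : ℝ) - (k : ℝ) / (Real.exp ε0 + 1)) ^ j
      ∧ (∑ m ∈ Finset.range (k + 1),
            mu0 ε0 k m * ((m : ℝ) - (k : ℝ) / (Real.exp ε0 + 1))) = 0
      ∧ (∑ m ∈ Finset.range (k + 1),
            mu0 ε0 k m * ((m : ℝ) - (k : ℝ) / (Real.exp ε0 + 1)) ^ 2)
          = (k : ℝ) * Real.exp ε0 / (Real.exp ε0 + 1) ^ 2 := by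
  refine ⟨?_, mu0_mean ε0 k, mu0_var ε0 k⟩
  have hE := Real.exp_pos ε0
  have h2 : Real.exp (2 * ε0) = Real.exp ε0 ^ 2 := by
    rw [← Real.exp_nat_mul]; norm_num
  have hk0 : (k : ℝ) ≠ 0 := by positivity
  set c := (Real.exp (2 * ε0) - 1) / ((k : ℝ) * Real.exp ε0) with hc
  have key : ∀ m ∈ Finset.range (k + 1),
      mu0 ε0 k m * (pDist ε0 γ k m / qDist ε0 k m) ^ lam
      = ∑ j ∈ Finset.range (lam + 1), (lam.choose j : ℝ) * γ ^ j * c ^ j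
          * (mu0 ε0 k m * ((m : ℝ) - (k : ℝ) / (Real.exp ε0 + 1)) ^ j) := by
    intro m hm
    have hm' : m ≤ k := by simpa [Nat.lt_succ_iff] using hm
    have h0 := mu0_ne ε0 k m hm'
    have hq : pDist ε0 γ k m / qDist ε0 k m
        = γ * c * ((m : ℝ) - (k : ℝ) / (Real.exp ε0 + 1)) + 1 := by
      rw [div_eq_iff (by exact h0)]
      unfold pDist qDist
      rw [mu1_eq ε0 k m hk hm', ← hc]
      ring
    rw [hq, add_pow, Finset.mul_sum]
    refine Finset.sum_congr rfl fun j _ => ?_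
    rw [one_pow, mul_pow, mul_pow]
    ring
  rw [Finset.sum_congr rfl key, Finset.sum_comm]
  simp only [← Finset.mul_sum]
  rw [Finset.range_eq_Ico, ← Finset.sum_Ico_consecutive _ (show 0 ≤ 3 by omega)
    (show 3 ≤ lam + 1 by omega)]
  have hI : Finset.Ico 3 (lam + 1) = Finset.Icc 3 lam := by
    ext; simp [Nat.lt_succ_iff]
  rw [hI]
  simp only [← Finset.range_eq_Ico]
  congr 1
  rw [Finset.sum_range_succ, Finset.sum_range_succ, Finset.sum_range_one]
  simp only [pow_zero, pow_one, mul_one, mu0_sum, mu0_mean, mu0_var, hc, h2, Nat.choose_zero_right]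
  field_simp
  ring
end

section
/- Nonnegativity of binomial central moments used in the lower-bound proof. Let k be a natural number, let ρ ∈ [0, 1/2], and let j be any natural number. Then the j-th central moment of the binomial distribution Bin(k, ρ) is nonnegative: Σ_{m=0}^{k} C(k,m) ρ^m (1−ρ)^{k−m} · (m − kρ)^j ≥ 0. -/
open Finset

lemma bern_moment_nonneg (ρ : ℝ) (h0 : 0 ≤ ρ) (h2 : ρ ≤ 1 / 2) (l : ℕ) :
    0 ≤ ρ * (1 - ρ) ^ l + (1 - ρ) * (-ρ) ^ l := by
  cases l with
  | zero => simp
  | succ n =>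
    have h : (-ρ) ^ n ≤ (1 - ρ) ^ n := by
      calc (-ρ) ^ n ≤ |(-ρ) ^ n| := le_abs_self _
        _ = ρ ^ n := by rw [abs_pow, abs_neg, abs_of_nonneg h0]
        _ ≤ (1 - ρ) ^ n := pow_le_pow_left₀ h0 (by linarith) n
    have h3 : 0 ≤ ρ * (1 - ρ) * ((1 - ρ) ^ n - (-ρ) ^ n) :=
      mul_nonneg (mul_nonneg h0 (by linarith)) (by linarith)
    calc 0 ≤ _ := h3
      _ = _ := by ring

/-- Nonnegativity of binomial central moments: for `ρ ∈ [0, 1/2]`, every central moment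
of `Bin(k, ρ)` is nonnegative. -/
theorem binomial_central_moment_nonneg
    (k : ℕ) (ρ : ℝ) (h0 : 0 ≤ ρ) (h2 : ρ ≤ 1 / 2) (j : ℕ) :
    0 ≤ ∑ m ∈ Finset.range (k + 1),
          (k.choose m : ℝ) * ρ ^ m * (1 - ρ) ^ (k - m) * ((m : ℝ) - (k : ℝ) * ρ) ^ j := by
  induction k generalizing j with
  | zero => by_cases h : j = 0 <;> simp [h]
  | succ k ih =>
    have key := Finset.sum_choose_succ_mul
      (fun a b : ℕ => ρ ^ a * (1 - ρ) ^ b * ((a : ℝ) - ((k + 1 : ℕ) : ℝ) * ρ) ^ j) k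
    have e : ∑ m ∈ Finset.range (k + 1 + 1), ((k + 1).choose m : ℝ) * ρ ^ m
          * (1 - ρ) ^ (k + 1 - m) * ((m : ℝ) - ((k + 1 : ℕ) : ℝ) * ρ) ^ j
        = ∑ i ∈ Finset.range (j + 1), (j.choose i : ℝ)
          * (ρ * (1 - ρ) ^ (j - i) + (1 - ρ) * (-ρ) ^ (j - i))
          * ∑ m ∈ Finset.range (k + 1),
          (k.choose m : ℝ) * ρ ^ m * (1 - ρ) ^ (k - m) * ((m : ℝ) - (k : ℝ) * ρ) ^ i := by
      simp only [mul_assoc] at key ⊢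
      rw [key, ← Finset.sum_add_distrib]
      simp only [Finset.mul_sum]
      rw [Finset.sum_comm]
      refine Finset.sum_congr rfl fun m hm => ?_
      have hm' : m ≤ k := by simpa [Nat.lt_succ_iff] using hm
      have e1 : (m : ℝ) - ((k + 1 : ℕ) : ℝ) * ρ = ((m : ℝ) - k * ρ) + (-ρ) := by
        push_cast; ring
      have e2 : ((m + 1 : ℕ) : ℝ) - ((k + 1 : ℕ) : ℝ) * ρ = ((m : ℝ) - k * ρ) + (1 - ρ) := by
        push_cast; ring
      rw [e1, e2, add_pow, add_pow, Nat.succ_sub hm', pow_succ, pow_succ]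
      simp only [Finset.mul_sum]
      rw [← Finset.sum_add_distrib]
      refine Finset.sum_congr rfl fun i _ => ?_
      ring
    rw [e]
    refine Finset.sum_nonneg fun i _ => ?_
    exact mul_nonneg (mul_nonneg (Nat.cast_nonneg _) (bern_moment_nonneg ρ h0 h2 _)) (ih i)
end

section
/- Binomial splitting bound for antitone functions (key step of the upper-bound proof). Let n be a natural number, γ ∈ [0,1], Δ ∈ [0,1], and set m = ⌊(1−Δ)nγ⌋. Let g : ℕ → ℝ be nonincreasing and nonnegative. Then Σ_{k=0}^{n} C(n,k) γ^k (1−γ)^{n−k} · g(k) ≤ g(0) · e^{−Δ² n γ / 2} + g(m+1). -/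
open Finset

/-- Binomial splitting bound for antitone functions (key step of the upper-bound proof):
if `g` is nonincreasing and nonnegative and `X ~ Bin(n, γ)`, then
`E[g(X)] ≤ g(0)·e^{−Δ²nγ/2} + g(⌊(1−Δ)nγ⌋ + 1)`. -/
theorem binomial_split_antitone_bound
    (n : ℕ) (γ Δ : ℝ) (hγ0 : 0 ≤ γ) (hγ1 : γ ≤ 1) (hΔ0 : 0 ≤ Δ) (hΔ1 : Δ ≤ 1)
    (g : ℕ → ℝ) (hg : Antitone g) (hg0 : ∀ k, 0 ≤ g k) :
    ∑ k ∈ Finset.range (n + 1), (n.choose k : ℝ) * γ ^ k * (1 - γ) ^ (n - k) * g k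
      ≤ g 0 * Real.exp (-Δ ^ 2 * (n : ℝ) * γ / 2) + g (⌊(1 - Δ) * (n : ℝ) * γ⌋₊ + 1) := by
  have hb : Real.exp (-Δ) ≤ 1 - Δ + Δ ^ 2 / 2 := by
    have h1 := Real.quadratic_le_exp_of_nonneg hΔ0
    have h2 : Real.exp (-Δ) * Real.exp Δ = 1 := by rw [← Real.exp_add]; simp
    have h3 : 0 < 1 - Δ + Δ ^ 2 / 2 := by nlinarith [sq_nonneg (Δ - 1)]
    have h4 : 1 ≤ (1 - Δ + Δ ^ 2 / 2) * Real.exp Δ := by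
      have h5 := mul_le_mul_of_nonneg_left h1 h3.le
      nlinarith [sq_nonneg (Δ ^ 2)]
    exact le_of_mul_le_mul_right (h2.le.trans h4) (Real.exp_pos Δ)
  set m := ⌊(1 - Δ) * (n : ℝ) * γ⌋₊ with hm
  set A := Real.exp (Δ * ((1 - Δ) * (n : ℝ) * γ)) with hA
  have hq : 0 ≤ 1 - γ := by linarith
  have hx : 0 ≤ (1 - Δ) * (n : ℝ) * γ :=
    mul_nonneg (mul_nonneg (by linarith) (Nat.cast_nonneg n)) hγ0
  have hpt : ∀ k, g k ≤ g 0 * (A * Real.exp (-Δ) ^ k) + g (m + 1) := by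
    intro k
    have he : A * Real.exp (-Δ) ^ k = Real.exp (Δ * ((1 - Δ) * (n : ℝ) * γ - k)) := by
      rw [hA, ← Real.exp_nat_mul, ← Real.exp_add]
      congr 1
      ring
    rw [he]
    by_cases hk : k ≤ m
    · have h1 : (k : ℝ) ≤ (1 - Δ) * (n : ℝ) * γ := (Nat.le_floor_iff hx).1 hk
      have h2 : 1 ≤ Real.exp (Δ * ((1 - Δ) * (n : ℝ) * γ - k)) :=
        Real.one_le_exp (mul_nonneg hΔ0 (by linarith))
      have h3 := le_mul_of_one_le_right (hg0 0) h2
      have h4 := hg (Nat.zero_le k)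
      linarith [hg0 (m + 1)]
    · have h1 : g k ≤ g (m + 1) := hg (by omega)
      have h2 := mul_nonneg (hg0 0) (Real.exp_pos (Δ * ((1 - Δ) * (n : ℝ) * γ - k))).le
      linarith
  have hs1 : ∑ k ∈ Finset.range (n + 1), (n.choose k : ℝ) * γ ^ k * (1 - γ) ^ (n - k) = 1 := by
    have h := add_pow γ (1 - γ) n
    rw [add_sub_cancel, one_pow] at h
    refine Eq.trans ?_ h.symm
    exact Finset.sum_congr rfl fun k _ => by ring
  have hs2 : ∑ k ∈ Finset.range (n + 1),
      (n.choose k : ℝ) * γ ^ k * (1 - γ) ^ (n - k) * Real.exp (-Δ) ^ k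
        = (γ * Real.exp (-Δ) + (1 - γ)) ^ n := by
    rw [add_pow]
    exact Finset.sum_congr rfl fun k _ => by rw [mul_pow]; ring
  have hmgf : (γ * Real.exp (-Δ) + (1 - γ)) ^ n ≤ Real.exp (n * (γ * (-Δ + Δ ^ 2 / 2))) := by
    rw [Real.exp_nat_mul]
    apply pow_le_pow_left₀ (add_nonneg (mul_nonneg hγ0 (Real.exp_pos _).le) hq)
    have h1 := Real.add_one_le_exp (γ * (-Δ + Δ ^ 2 / 2))
    have h2 := mul_le_mul_of_nonneg_left hb hγ0
    linarith
  calc ∑ k ∈ Finset.range (n + 1), (n.choose k : ℝ) * γ ^ k * (1 - γ) ^ (n - k) * g k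
      ≤ ∑ k ∈ Finset.range (n + 1), (n.choose k : ℝ) * γ ^ k * (1 - γ) ^ (n - k) *
          (g 0 * (A * Real.exp (-Δ) ^ k) + g (m + 1)) :=
        Finset.sum_le_sum fun k _ => mul_le_mul_of_nonneg_left (hpt k) (by positivity)
    _ = g 0 * (A * ∑ k ∈ Finset.range (n + 1),
          (n.choose k : ℝ) * γ ^ k * (1 - γ) ^ (n - k) * Real.exp (-Δ) ^ k)
        + (∑ k ∈ Finset.range (n + 1),
          (n.choose k : ℝ) * γ ^ k * (1 - γ) ^ (n - k)) * g (m + 1) := by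
        rw [Finset.mul_sum, Finset.mul_sum, Finset.sum_mul, ← Finset.sum_add_distrib]
        exact Finset.sum_congr rfl fun k _ => by ring
    _ ≤ g 0 * (A * Real.exp (n * (γ * (-Δ + Δ ^ 2 / 2)))) + g (m + 1) := by
        rw [hs1, hs2, one_mul]
        have h1 := mul_le_mul_of_nonneg_left
          (mul_le_mul_of_nonneg_left hmgf (Real.exp_pos (Δ * ((1 - Δ) * (n : ℝ) * γ))).le) (hg0 0)
        linarith
    _ = g 0 * Real.exp (-Δ ^ 2 * (n : ℝ) * γ / 2) + g (m + 1) := by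
        rw [hA, ← Real.exp_add]
        congr 3
        ring
end
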